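/- arXiv:2102.00520 — 3 statements merged into one kernel-verified Lean document; each statement's English description precedes it below -/
import Mathlib

section
/- Let K be a field of characteristic 0 and let S be a finite set of pairwise non-associate irreducible polynomials in K[z] = K[z_1,…,z_n]. Then the K-linear map K^{(S)} → Ω^1_{K(z)/K} sending (λ_F)_{F∈S} to Σ_{F∈S} λ_F · dF/F is injective; equivalently, if Σ_{F∈S} λ_F dF/F = 0 with all λ_F ∈ K, then all λ_F = 0. -/
set_option synthInstance.maxHeartbeats 1000000
set_option maxHeartbeats 4000000

noncomputable section
open MvPolynomial

/-- The field of rational functions `K(z₁,…,zₙ)`. -/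
abbrev Kz (K : Type) [Field K] (n : ℕ) := FractionRing (MvPolynomial (Fin n) K)

variable (K : Type) [Field K] (n : ℕ)

/-- The inclusion of polynomials into rational functions. -/
def toKz : MvPolynomial (Fin n) K →+* Kz K n := algebraMap _ _

theorem MvPolynomial.exists_not_dvd_pderiv {σ R : Type*} [CommRing R] [IsDomain R] [CharZero R]
    {F : MvPolynomial σ R} (hF : F.vars.Nonempty) : ∃ i, ¬ F ∣ pderiv i F := by
  obtain ⟨i, hi⟩ := hF
  have hpos : 0 < degreeOf i F := Nat.pos_of_ne_zero (mem_vars_iff_degreeOf_ne_zero.1 hi)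
  have hF0 : F ≠ 0 := by
    rintro rfl
    simp at hi
  obtain ⟨k, hk, hkd⟩ := Finset.exists_mem_eq_sup F.support (support_nonempty.2 hF0) fun m => m i
  rw [← degreeOf_eq_sup] at hkd
  have hk1 : k - Finsupp.single i 1 + Finsupp.single i 1 = k := by
    refine tsub_add_cancel_of_le (Finsupp.single_le_iff.2 ?_)
    omega
  have hne : pderiv i F ≠ 0 := by
    intro h
    have hc := coeff_pderiv (i := i) F (k - Finsupp.single i 1)
    rw [h, hk1, coeff_zero] at hc
    rcases mul_eq_zero.1 hc.symm with h0 | h0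
    · exact mem_support_iff.1 hk h0
    · exact absurd h0 (Nat.cast_add_one_ne_zero _)
  have hlt : degreeOf i (pderiv i F) < degreeOf i F := by
    refine (degreeOf_lt_iff hpos).2 fun a ha => ?_
    rw [mem_support_iff, coeff_pderiv] at ha
    have := monomial_le_degreeOf i (mem_support_iff.2 (left_ne_zero_of_mul ha))
    simp at this
    omega
  refine ⟨i, fun ⟨G, hG⟩ => ?_⟩
  have hG0 : G ≠ 0 := by
    rintro rfl
    exact hne (by rw [hG, mul_zero])
  rw [hG, degreeOf_mul_eq hF0 hG0] at hlt
  omega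

theorem MvPolynomial.vars_nonempty_of_irreducible {σ k : Type*} [Field k]
    {F : MvPolynomial σ k} (hF : Irreducible F) : F.vars.Nonempty := by
  rw [Finset.nonempty_iff_ne_empty, Ne, vars_eq_empty_iff_eq_C]
  intro h
  have hc : F.coeff 0 ≠ 0 := by
    intro h0
    rw [h0, C_0] at h
    exact hF.ne_zero h
  exact hF.not_isUnit (h ▸ (isUnit_iff_ne_zero.2 hc).map C)

/-- If a derivation on a ring kills the logarithmic combination `∑ a_G dG/G` after clearing
denominators, then a prime `F` among the `G`, not associated to the others, divides
`a_F * dF`. -/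
theorem Prime.dvd_mul_of_sum_mul_prod_erase_eq_zero {A : Type*} [CommRing A] [IsDomain A]
    [DecidableEq A] {S : Finset A} {F : A} (hF : Prime F) (hFS : F ∈ S)
    (hdvd : ∀ G ∈ S, F ≠ G → ¬ F ∣ G) (a δ : A → A)
    (h : ∑ G ∈ S, (a G * ∏ H ∈ S.erase G, H) * δ G = 0) : F ∣ a F * δ F := by
  rw [← Finset.add_sum_erase S _ hFS] at h
  have hrest : F ∣ ∑ G ∈ S.erase F, (a G * ∏ H ∈ S.erase G, H) * δ G := by
    refine Finset.dvd_sum fun G hG => Dvd.dvd.mul_right (Dvd.dvd.mul_left ?_ _) _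
    exact Finset.dvd_prod_of_mem _ (Finset.mem_erase.2 ⟨(Finset.ne_of_mem_erase hG).symm, hFS⟩)
  have hterm : F ∣ (∏ H ∈ S.erase F, H) * (a F * δ F) := by
    have := (dvd_add_left hrest).1 (h ▸ dvd_zero F)
    convert this using 1
    ring
  refine (hF.dvd_or_dvd hterm).resolve_left fun hprod => ?_
  obtain ⟨G, hG, hFG⟩ := hF.exists_mem_finset_dvd hprod
  exact hdvd G (Finset.mem_of_mem_erase hG) (Finset.ne_of_mem_erase hG).symm hFG

/-- A `K`-derivation of a domain `A` kills every relation between the differentials of elements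
of `A` that holds in the Kähler differentials of its fraction field. -/
theorem Derivation.sum_mul_eq_zero_of_fractionRing {k A ι : Type*} [CommRing k] [CommRing A]
    [IsDomain A] [Algebra k A] (δ : Derivation k A A) (s : Finset ι) (b x : ι → A)
    (h : ∑ i ∈ s, algebraMap A (FractionRing A) (b i) •
      KaehlerDifferential.D k (FractionRing A) (algebraMap A (FractionRing A) (x i)) = 0) :
    ∑ i ∈ s, b i * δ (x i) = 0 := by
  have hmap : KaehlerDifferential.map k k A (FractionRing A)
      (∑ i ∈ s, b i • KaehlerDifferential.D k A (x i)) = 0 := by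
    rw [← h, _root_.map_sum]
    refine Finset.sum_congr rfl fun i _ => ?_
    rw [_root_.map_smul, KaehlerDifferential.map_D, algebraMap_smul]
  obtain ⟨t, ht⟩ := (IsLocalizedModule.eq_zero_iff (nonZeroDivisors A) _).1 hmap
  have ht' := congrArg δ.liftKaehlerDifferential ht
  rw [Submonoid.smul_def, _root_.map_smul, _root_.map_zero, _root_.map_sum, smul_eq_mul] at ht'
  simpa using (mul_eq_zero.1 ht').resolve_left (nonZeroDivisors.ne_zero t.2)

/-- (Jouanolou's lemma, characteristic `0`.) If `S` is a finite set of pairwise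
non-associate irreducible polynomials in `K[z₁,…,zₙ]`, `K` of characteristic `0`, then the
`K`-linear map `(λ_F)_{F ∈ S} ↦ ∑_{F ∈ S} λ_F · dF/F` into `Ω¹_{K(z)/K}` is injective,
i.e. if `∑_{F ∈ S} λ_F dF/F = 0` with all `λ_F ∈ K`, then all `λ_F = 0`. -/
theorem statement2 [CharZero K] (S : Finset (MvPolynomial (Fin n) K))
    (hirr : ∀ F ∈ S, Irreducible F)
    (hna : ∀ F ∈ S, ∀ G ∈ S, F ≠ G → ¬ Associated F G)
    (lam : MvPolynomial (Fin n) K → K)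
    (hrel : ∑ F ∈ S, (algebraMap K (Kz K n) (lam F) / toKz K n F) •
        KaehlerDifferential.D K (Kz K n) (toKz K n F) = 0) :
    ∀ F ∈ S, lam F = 0 := by
  classical
  intro F hF
  obtain ⟨i, hi⟩ := exists_not_dvd_pderiv (vars_nonempty_of_irreducible (hirr F hF))
  have hne : ∀ G ∈ S, toKz K n G ≠ 0 := fun G hG =>
    (map_ne_zero_iff _ (IsFractionRing.injective (MvPolynomial (Fin n) K) (Kz K n))).2
      (hirr G hG).ne_zero
  have hclear : ∑ G ∈ S, algebraMap (MvPolynomial (Fin n) K) (Kz K n)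
      (C (lam G) * ∏ H ∈ S.erase G, H) •
        KaehlerDifferential.D K (Kz K n) (toKz K n G) = 0 := by
    rw [← smul_zero (toKz K n (∏ H ∈ S, H)), ← hrel, Finset.smul_sum]
    refine Finset.sum_congr rfl fun G hG => ?_
    rw [smul_smul, ← Finset.mul_prod_erase S (fun H => H) hG, map_mul, map_mul]
    congr 1
    have hC : algebraMap (MvPolynomial (Fin n) K) (Kz K n) (C (lam G)) =
        algebraMap K (Kz K n) (lam G) :=
      (IsScalarTower.algebraMap_apply K (MvPolynomial (Fin n) K) (Kz K n) _).symm
    rw [hC]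
    change _ * toKz K n _ = _
    field_simp [hne G hG]
  have hsum := (pderiv i).sum_mul_eq_zero_of_fractionRing S _ _ hclear
  have hdvd := (hirr F hF).prime.dvd_mul_of_sum_mul_prod_erase_eq_zero hF
    (fun G hG hFG h => hna F hF G hG hFG ((hirr F hF).associated_of_dvd (hirr G hG) h))
    (fun G => C (lam G)) (pderiv i) hsum
  by_contra hlam
  exact hi (((isUnit_iff_ne_zero.2 hlam).map C).dvd_mul_left.1 hdvd)
end
end

section
/- Let K be a field and ω a polynomial r-form on K^n. If there exist pairwise non-associate irreducible polynomials F_1,…,F_m ∈ K[z] invariant by ω and integers δ_1,…,δ_m (elements of the prime subfield Z_p of K if char K = p > 0), not all zero, such that δ_1Θ_{F_1}+…+δ_mΘ_{F_m} = 0, then ω has a rational first integral, namely f = F_1^{δ_1}⋯F_m^{δ_m} (a polynomial first integral when the δ_i are nonnegative). -/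
/- Framework: rational function field `K(z) = K(z₁,…,zₙ)`, its subfield `K(zᵖ)` of
∂-constants, and rational differential forms modelled as the exterior algebra over `K(z)`
on the free module with basis `dz₁,…,dzₙ` (canonically isomorphic to the exterior powers
of the Kähler differentials `Ω¹_{K(z)/K}`); the wedge product is the algebra product. -/

set_option synthInstance.maxHeartbeats 1000000
set_option maxHeartbeats 4000000

noncomputable section
open MvPolynomial

variable (K : Type) [Field K] (n : ℕ)

/-- Rational differential forms on `Kⁿ`. -/
abbrev Forms (K : Type) [Field K] (n : ℕ) := ExteriorAlgebra (Kz K n) (Fin n → Kz K n)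

/-- The 1-form `dz i`. -/
def dz (i : Fin n) : Forms K n := ExteriorAlgebra.ι (Kz K n) (Pi.single i 1)

/-- The 1-form with coordinates `v` with respect to the basis `dz₁,…,dzₙ`. -/
def oneForm (v : Fin n → Kz K n) : Forms K n := ExteriorAlgebra.ι (Kz K n) v

/-- The `r`-form `dz_{s 0} ∧ ⋯ ∧ dz_{s (r-1)}`. -/
def dzP (r : ℕ) (s : Fin r → Fin n) : Forms K n := (List.ofFn fun i => dz K n (s i)).prod

/-- The partial derivative `∂/∂zᵢ`, extended from `K[z]` to `K(z)` by the quotient rule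
(applied to a chosen fraction representation; the value does not depend on the choice). -/
def pd (i : Fin n) (f : Kz K n) : Kz K n :=
  let a := (IsLocalization.sec (nonZeroDivisors (MvPolynomial (Fin n) K)) f).1
  let b := ((IsLocalization.sec (nonZeroDivisors (MvPolynomial (Fin n) K)) f).2 :
      MvPolynomial (Fin n) K)
  (toKz K n (pderiv i a) * toKz K n b - toKz K n a * toKz K n (pderiv i b)) / (toKz K n b) ^ 2

/-- The differential `df = ∑ᵢ (∂f/∂zᵢ) dzᵢ` of a rational function `f`. -/
def dd (f : Kz K n) : Forms K n := ∑ i, pd K n i f • dz K n i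

/-- The `r`-form with (rational) coefficients `c`. -/
def formOf (r : ℕ) (c : (Fin r → Fin n) → Kz K n) : Forms K n := ∑ s, c s • dzP K n r s

/-- The exterior derivative of the `r`-form with coefficients `c`:
`d(∑ c_s dz_s) = ∑ (d c_s) ∧ dz_s`. -/
def Dform (r : ℕ) (c : (Fin r → Fin n) → Kz K n) : Forms K n := ∑ s, dd K n (c s) * dzP K n r s

/-- The polynomial `r`-form with polynomial coefficients `c`. -/
def polyFormOf (r : ℕ) (c : (Fin r → Fin n) → MvPolynomial (Fin n) K) : Forms K n :=
  formOf K n r fun s => toKz K n (c s)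

/-- The exterior derivative of the polynomial `r`-form with coefficients `c`. -/
def Dpoly (r : ℕ) (c : (Fin r → Fin n) → MvPolynomial (Fin n) K) : Forms K n :=
  Dform K n r fun s => toKz K n (c s)

/-- The exterior derivative of the 1-form with coordinates `v`. -/
def d1 (v : Fin n → Kz K n) : Forms K n := ∑ j, dd K n (v j) * dz K n j

/-- The subfield `K(zᵖ) = K(z₁ᵖ,…,zₙᵖ) ⊆ K(z)` of ∂-constants. -/
def pConsts (p : ℕ) : Subfield (Kz K n) :=
  Subfield.closure (Set.range (algebraMap K (Kz K n)) ∪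
    Set.range fun i : Fin n => (toKz K n (X i)) ^ p)

/-- `F` is invariant by the `r`-form `ω`: `dF ≠ 0` and `F` divides `ω ∧ dF`,
the quotient being a polynomial `(r+1)`-form (the cofactor `Θ_F`). -/
def FormInvariant (r : ℕ) (ω : Forms K n) (F : MvPolynomial (Fin n) K) : Prop :=
  dd K n (toKz K n F) ≠ 0 ∧
    ∃ Θ : (Fin (r + 1) → Fin n) → MvPolynomial (Fin n) K,
      ω * dd K n (toKz K n F) = toKz K n F • polyFormOf K n (r + 1) Θ

/-- `f` is a rational first integral of the form `ω`: `df ≠ 0` and `ω ∧ df = 0`. -/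
def IsFirstIntegral (ω : Forms K n) (f : Kz K n) : Prop :=
  dd K n f ≠ 0 ∧ ω * dd K n f = 0

/-- The `K(zᵖ)`-subspace `Ω^r_{L_d/K(zᵖ)}` spanned by the forms
`z^I · dz_{s 0} ∧ ⋯ ∧ dz_{s (r-1)}` with `0 ≤ I j ≤ p−1` and `∑ I ≤ d`. -/
def Lforms (p d r : ℕ) : Submodule (pConsts K n p) (Forms K n) :=
  Submodule.span (pConsts K n p)
    { x | ∃ (I : Fin n → ℕ) (s : Fin r → Fin n), (∀ j, I j ≤ p - 1) ∧ (∑ j, I j ≤ d) ∧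
        x = toKz K n (∏ j, X j ^ I j) • dzP K n r s }

/-- `N_K(n,d,r) = dim_{K(zᵖ)} Ω^r_{L_d/K(zᵖ)}`. -/
def NK (p d r : ℕ) : ℕ := Module.finrank (pConsts K n p) (Lforms K n p d r)

/-- The submodule of `r`-forms (the `r`-th exterior power of the module of 1-forms). -/
def gradeR (r : ℕ) : Submodule (Kz K n) (Forms K n) :=
  (LinearMap.range (ExteriorAlgebra.ι (Kz K n) :
      (Fin n → Kz K n) →ₗ[Kz K n] Forms K n)) ^ r

theorem toKz_injective : Function.Injective (toKz K n) :=
  IsFractionRing.injective (MvPolynomial (Fin n) K) (Kz K n)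

theorem toKz_ne_zero {P : MvPolynomial (Fin n) K} (hP : P ≠ 0) : toKz K n P ≠ 0 :=
  (map_ne_zero_iff _ (toKz_injective K n)).2 hP

theorem exists_eq_toKz_div (f : Kz K n) :
    ∃ a b : MvPolynomial (Fin n) K, b ≠ 0 ∧ f = toKz K n a / toKz K n b := by
  obtain ⟨a, b, hb, h⟩ := IsFractionRing.div_surjective (A := MvPolynomial (Fin n) K) f
  exact ⟨a, b, nonZeroDivisors.ne_zero hb, h.symm⟩

/-- The quotient rule does not depend on the chosen fraction. -/
theorem pd_eq_of_mul_eq (i : Fin n) {f : Kz K n} {a b : MvPolynomial (Fin n) K} (hb : b ≠ 0)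
    (h : f * toKz K n b = toKz K n a) :
    pd K n i f =
      (toKz K n (pderiv i a) * toKz K n b - toKz K n a * toKz K n (pderiv i b)) /
        toKz K n b ^ 2 := by
  set s := IsLocalization.sec (nonZeroDivisors (MvPolynomial (Fin n) K)) f
  have hb' : (s.2 : MvPolynomial (Fin n) K) ≠ 0 := nonZeroDivisors.ne_zero s.2.2
  have hf : f * toKz K n s.2 = toKz K n s.1 := IsLocalization.sec_spec _ f
  have hpoly : a * (s.2 : MvPolynomial (Fin n) K) = s.1 * b := by
    apply toKz_injective K n
    rw [map_mul, map_mul, ← h, ← hf]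
    ring
  have hder := congrArg (fun P => toKz K n (pderiv i P)) hpoly
  have hpoly' := congrArg (toKz K n) hpoly
  simp only [pderiv_mul, map_mul, map_add] at hder hpoly'
  have hB := toKz_ne_zero K n hb
  have hB' := toKz_ne_zero K n hb'
  change (toKz K n (pderiv i s.1) * toKz K n s.2 - toKz K n s.1 * toKz K n (pderiv i s.2)) /
    toKz K n s.2 ^ 2 = _
  rw [div_eq_div_iff (pow_ne_zero 2 hB') (pow_ne_zero 2 hB)]
  linear_combination (-(toKz K n b * toKz K n s.2)) * hder +
    (toKz K n b * toKz K n (pderiv i s.2) + toKz K n s.2 * toKz K n (pderiv i b)) * hpoly'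

theorem pd_toKz (i : Fin n) (P : MvPolynomial (Fin n) K) :
    pd K n i (toKz K n P) = toKz K n (pderiv i P) := by
  rw [pd_eq_of_mul_eq K n i (a := P) one_ne_zero (by simp)]
  simp

theorem pd_one (i : Fin n) : pd K n i 1 = 0 := by
  simpa using pd_toKz K n i 1

theorem pd_mul (i : Fin n) (f g : Kz K n) :
    pd K n i (f * g) = pd K n i f * g + f * pd K n i g := by
  obtain ⟨a, b, hb, rfl⟩ := exists_eq_toKz_div K n f
  obtain ⟨a', b', hb', rfl⟩ := exists_eq_toKz_div K n g
  have hB := toKz_ne_zero K n hb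
  have hB' := toKz_ne_zero K n hb'
  rw [pd_eq_of_mul_eq K n i hb (div_mul_cancel₀ _ hB),
    pd_eq_of_mul_eq K n i hb' (div_mul_cancel₀ _ hB'),
    pd_eq_of_mul_eq K n i (a := a * a') (mul_ne_zero hb hb')
      (by rw [map_mul, map_mul]; field_simp)]
  simp only [pderiv_mul, map_mul, map_add]
  field_simp
  ring

/-- Logarithmic partial derivative, as a homomorphism from the multiplicative group of `K(z)`. -/
def logPd (i : Fin n) : (Kz K n)ˣ →* Multiplicative (Kz K n) where
  toFun u := Multiplicative.ofAdd ((u : Kz K n)⁻¹ * pd K n i u)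
  map_one' := by simp [pd_one]
  map_mul' u v := by
    rw [← ofAdd_add, Units.val_mul, pd_mul]
    congr 1
    have hu := u.ne_zero
    have hv := v.ne_zero
    field_simp

theorem pd_prod_zpow {m : ℕ} (i : Fin n) (f : Fin m → Kz K n) (hf : ∀ j, f j ≠ 0)
    (δ : Fin m → ℤ) :
    pd K n i (∏ j, f j ^ δ j) =
      (∏ j, f j ^ δ j) * ∑ j, (δ j : Kz K n) * ((f j)⁻¹ * pd K n i (f j)) := by
  have h := congrArg Multiplicative.toAdd
    (map_prod (logPd K n i) (fun j => Units.mk0 (f j) (hf j) ^ δ j) Finset.univ)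
  have h0 : (∏ j, f j ^ δ j) ≠ 0 := Finset.prod_ne_zero_iff.2 fun j _ => zpow_ne_zero _ (hf j)
  simp only [logPd, map_zpow, MonoidHom.coe_mk, OneHom.coe_mk, Units.coe_prod,
    Units.val_zpow_eq_zpow_val, Units.val_mk0, toAdd_ofAdd, toAdd_prod, toAdd_zpow,
    zsmul_eq_mul] at h
  rw [← h, mul_inv_cancel_left₀ h0]

theorem dd_prod_zpow {m : ℕ} (f : Fin m → Kz K n) (hf : ∀ j, f j ≠ 0) (δ : Fin m → ℤ) :
    dd K n (∏ j, f j ^ δ j) =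
      (∏ j, f j ^ δ j) • ∑ j, δ j • ((f j)⁻¹ • dd K n (f j)) := by
  simp only [dd, pd_prod_zpow K n _ f hf, Finset.smul_sum, Finset.sum_smul, mul_smul,
    Int.cast_smul_eq_zsmul, Finset.mul_sum]
  exact Finset.sum_comm

theorem dd_eq_oneForm (f : Kz K n) : dd K n f = oneForm K n fun i => pd K n i f := by
  simp only [dd, dz, oneForm, ← map_smul, ← map_sum]
  congr 1
  ext j
  simp [Finset.sum_apply, Pi.single_apply]

theorem dd_eq_zero_iff (f : Kz K n) : dd K n f = 0 ↔ ∀ i, pd K n i f = 0 := by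
  rw [dd_eq_oneForm, oneForm, ExteriorAlgebra.ι_eq_zero_iff, funext_iff]
  rfl

theorem pderiv_eq_zero_of_dvd {σ R : Type*} [CommRing R] [NoZeroDivisors R] (i : σ)
    {P : MvPolynomial σ R} (h : P ∣ pderiv i P) : pderiv i P = 0 := by
  by_contra h0
  obtain ⟨Q, hQ⟩ := h
  have hP : P ≠ 0 := by rintro rfl; simp at h0
  have hQ0 : Q ≠ 0 := by rintro rfl; simp [hQ] at h0
  obtain ⟨s, hs, hdeg⟩ := Finset.exists_mem_eq_sup (pderiv i P).support
    (support_nonempty.2 h0) fun t => t i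
  rw [← degreeOf_eq_sup] at hdeg
  have hs' : s + Finsupp.single i 1 ∈ P.support := by
    rw [mem_support_iff, coeff_pderiv] at hs
    exact mem_support_iff.2 (left_ne_zero_of_mul hs)
  have hle := monomial_le_degreeOf i hs'
  have hmul := degreeOf_mul_eq (n := i) hP hQ0
  rw [← hQ] at hmul
  simp only [Finsupp.add_apply, Finsupp.single_eq_same] at hle
  omega

/-- Logarithmic derivatives of pairwise non-associate irreducible polynomials with nonzero
differential are linearly independent over the prime subfield. -/
theorem dd_prod_zpow_ne_zero {m : ℕ} (F : Fin m → MvPolynomial (Fin n) K)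
    (hirr : ∀ i, Irreducible (F i)) (hna : ∀ i j, i ≠ j → ¬ Associated (F i) (F j))
    (hdF : ∀ i, dd K n (toKz K n (F i)) ≠ 0) (δ : Fin m → ℤ) (hδ : ∃ i, (δ i : K) ≠ 0) :
    dd K n (∏ i, toKz K n (F i) ^ δ i) ≠ 0 := by
  classical
  intro h
  obtain ⟨j, hj⟩ := hδ
  have hne : ∀ i, toKz K n (F i) ≠ 0 := fun i => toKz_ne_zero K n (hirr i).ne_zero
  refine hdF j ((dd_eq_zero_iff K n _).2 fun k => ?_)
  have hk := (dd_eq_zero_iff K n _).1 h k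
  rw [pd_prod_zpow K n k _ hne] at hk
  have hsum := (mul_eq_zero.1 hk).resolve_left
    (Finset.prod_ne_zero_iff.2 fun i _ => zpow_ne_zero _ (hne i))
  have hpoly : ∑ i, (δ i : MvPolynomial (Fin n) K) *
      ((∏ l ∈ Finset.univ.erase i, F l) * pderiv k (F i)) = 0 := by
    apply toKz_injective K n
    rw [map_zero, ← mul_zero (∏ l, toKz K n (F l)), ← hsum, map_sum, Finset.mul_sum]
    refine Finset.sum_congr rfl fun i _ => ?_
    rw [← Finset.mul_prod_erase _ _ (Finset.mem_univ i), pd_toKz]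
    simp only [map_mul, map_prod, map_intCast]
    have := hne i
    field_simp
  have hprime : Prime (F j) := (hirr j).prime
  rw [← Finset.add_sum_erase _ _ (Finset.mem_univ j)] at hpoly
  have hdvd : F j ∣ (δ j : MvPolynomial (Fin n) K) *
      ((∏ l ∈ Finset.univ.erase j, F l) * pderiv k (F j)) := by
    rw [eq_neg_of_add_eq_zero_left hpoly, dvd_neg]
    refine Finset.dvd_sum fun i hi => Dvd.dvd.mul_left (Dvd.dvd.mul_right ?_ _) _
    exact Finset.dvd_prod_of_mem _
      (Finset.mem_erase.2 ⟨(Finset.ne_of_mem_erase hi).symm, Finset.mem_univ j⟩)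
  have hunit : IsUnit (δ j : MvPolynomial (Fin n) K) := by
    rw [← map_intCast (C : K →+* MvPolynomial (Fin n) K)]
    exact (isUnit_iff_ne_zero.2 hj).map C
  rw [hunit.dvd_mul_left] at hdvd
  have hP : F j ∣ pderiv k (F j) := by
    refine (hprime.dvd_or_dvd hdvd).resolve_left fun hprod => ?_
    obtain ⟨l, hl, hdl⟩ := (hprime.dvd_finsetProd_iff _).1 hprod
    exact hna j l (Finset.ne_of_mem_erase hl).symm ((hirr j).associated_of_dvd (hirr l) hdl)
  rw [pd_toKz, pderiv_eq_zero_of_dvd k hP, map_zero]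

/-- If the polynomial `r`-form `ω` has pairwise non-associate invariant irreducible
polynomials `F₁,…,F_m` with cofactors `Θ_{F₁},…,Θ_{F_m}` and there are integers
`δ₁,…,δ_m` (viewed in the prime subfield of `K`), not all zero, with
`δ₁Θ_{F₁} + ⋯ + δ_mΘ_{F_m} = 0`, then `f = F₁^{δ₁} ⋯ F_m^{δ_m}` is a rational first
integral of `ω` (a polynomial one when all `δᵢ ≥ 0`). -/
theorem statement8 (r m : ℕ)
    (c : (Fin r → Fin n) → MvPolynomial (Fin n) K)
    (F : Fin m → MvPolynomial (Fin n) K)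
    (hirr : ∀ i, Irreducible (F i))
    (hna : ∀ i j, i ≠ j → ¬ Associated (F i) (F j))
    (hdF : ∀ i, dd K n (toKz K n (F i)) ≠ 0)
    (Θ : Fin m → ((Fin (r + 1) → Fin n) → MvPolynomial (Fin n) K))
    (hcof : ∀ i, polyFormOf K n r c * dd K n (toKz K n (F i)) =
        toKz K n (F i) • polyFormOf K n (r + 1) (Θ i))
    (δ : Fin m → ℤ) (hδ : ∃ i, (δ i : K) ≠ 0)
    (hrel : ∑ i, δ i • polyFormOf K n (r + 1) (Θ i) = 0) :
    IsFirstIntegral K n (polyFormOf K n r c) (∏ i, toKz K n (F i) ^ (δ i)) ∧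
      ((∀ i, 0 ≤ δ i) →
        ∃ P : MvPolynomial (Fin n) K, (∏ i, toKz K n (F i) ^ (δ i)) = toKz K n P) := by
  have hne : ∀ i, toKz K n (F i) ≠ 0 := fun i => toKz_ne_zero K n (hirr i).ne_zero
  refine ⟨⟨dd_prod_zpow_ne_zero K n F hirr hna hdF δ hδ, ?_⟩, fun h => ?_⟩
  · rw [dd_prod_zpow K n _ hne, mul_smul_comm, Finset.mul_sum]
    refine Eq.trans (congrArg _ (Finset.sum_congr rfl fun i _ => ?_)) ((congrArg _ hrel).trans
      (smul_zero _))
    rw [mul_smul_comm, mul_smul_comm, hcof, inv_smul_smul₀ (hne i)]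
  · refine ⟨∏ i, F i ^ (δ i).toNat, ?_⟩
    rw [map_prod]
    refine Finset.prod_congr rfl fun i _ => ?_
    rw [map_pow, ← zpow_natCast, Int.toNat_of_nonneg (h i)]
end
end

section
/- Let K be a field of characteristic p > 0 and f = P/Q ∈ K(z) a rational function with df ≠ 0. Then there are infinitely many pairwise non-associate irreducible polynomials G ∈ K[z] with dG ≠ 0 such that G divides P + λQ for some λ ∈ K[z^p]. -/
set_option synthInstance.maxHeartbeats 1000000
set_option maxHeartbeats 4000000

noncomputable section
open MvPolynomial

variable (K : Type) [Field K] (n : ℕ)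

/-- The subring `K[zᵖ] = K[z₁ᵖ,…,zₙᵖ] ⊆ K[z]`. -/
def pPolyConsts (p : ℕ) : Subalgebra K (MvPolynomial (Fin n) K) :=
  Algebra.adjoin K (Set.range fun i : Fin n => (X i : MvPolynomial (Fin n) K) ^ p)

variable {K n} in
/-- A `p`-th power is a constant for every derivation in characteristic `p`. -/
lemma D_pow_char_eq_zero (p : ℕ) [CharP K p] (s : MvPolynomial (Fin n) K) :
    KaehlerDifferential.D K (MvPolynomial (Fin n) K) (s ^ p) = 0 := by
  rw [Derivation.leibniz_pow, ← Nat.cast_smul_eq_nsmul K, CharP.cast_eq_zero, zero_smul]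

variable {K n} in
lemma D_mul_eq_zero {a b : MvPolynomial (Fin n) K}
    (ha : KaehlerDifferential.D K (MvPolynomial (Fin n) K) a = 0)
    (hb : KaehlerDifferential.D K (MvPolynomial (Fin n) K) b = 0) :
    KaehlerDifferential.D K (MvPolynomial (Fin n) K) (a * b) = 0 := by
  rw [Derivation.leibniz, ha, hb, smul_zero, smul_zero, add_zero]

variable {K n} in
lemma D_isUnit_eq_zero {a : MvPolynomial (Fin n) K} (ha : IsUnit a) :
    KaehlerDifferential.D K (MvPolynomial (Fin n) K) a = 0 := by
  obtain ⟨r, -, rfl⟩ := MvPolynomial.isUnit_iff_eq_C_of_isReduced.mp ha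
  exact Derivation.map_algebraMap _ r

variable {K n} in
lemma D_eq_zero_of_mem_pPolyConsts (p : ℕ) [CharP K p] {a : MvPolynomial (Fin n) K}
    (ha : a ∈ pPolyConsts K n p) :
    KaehlerDifferential.D K (MvPolynomial (Fin n) K) a = 0 := by
  induction ha using Algebra.adjoin_induction with
  | mem x hx => obtain ⟨i, rfl⟩ := hx; exact D_pow_char_eq_zero p _
  | algebraMap r => exact Derivation.map_algebraMap _ r
  | add x y _ _ hx hy => rw [map_add, hx, hy, add_zero]
  | mul x y _ _ hx hy => exact D_mul_eq_zero hx hy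

variable {K n} in
/-- A rational function that is a quotient of constants is a constant. -/
lemma D_eq_zero_of_mul_eq {a b : MvPolynomial (Fin n) K} {f : Kz K n}
    (ha : KaehlerDifferential.D K (MvPolynomial (Fin n) K) a = 0)
    (hb : KaehlerDifferential.D K (MvPolynomial (Fin n) K) b = 0)
    (ha0 : a ≠ 0) (h : toKz K n a * f = toKz K n b) :
    KaehlerDifferential.D K (Kz K n) f = 0 := by
  have key : ∀ c : MvPolynomial (Fin n) K,
      KaehlerDifferential.D K (MvPolynomial (Fin n) K) c = 0 →
      KaehlerDifferential.D K (Kz K n) (toKz K n c) = 0 := fun c hc => by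
    have := KaehlerDifferential.map_D K K (MvPolynomial (Fin n) K) (Kz K n) c
    rw [hc, map_zero] at this
    exact this.symm
  have h1 := congrArg (KaehlerDifferential.D K (Kz K n)) h
  rw [Derivation.leibniz, key a ha, key b hb, smul_zero, add_zero] at h1
  refine (smul_eq_zero.mp h1).resolve_left ?_
  exact (map_ne_zero_iff _ (IsFractionRing.injective (MvPolynomial (Fin n) K) (Kz K n))).mpr ha0

variable {K n} in
/-- A nonzero polynomial all of whose non-constant irreducible factors are associate to members
of `S` is a constant times a product of powers of members of `S`. -/
lemma exists_eq_const_mul_prod_pow (S : Finset (MvPolynomial (Fin n) K))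
    (R : MvPolynomial (Fin n) K) (hR : R ≠ 0)
    (hS : ∀ G, Irreducible G → KaehlerDifferential.D K (MvPolynomial (Fin n) K) G ≠ 0 → G ∣ R →
      ∃ G' ∈ S, Associated G G') :
    ∃ c, KaehlerDifferential.D K (MvPolynomial (Fin n) K) c = 0 ∧
      ∃ e : MvPolynomial (Fin n) K → ℕ, R = c * ∏ s ∈ S, s ^ e s := by
  classical
  induction R using WfDvdMonoid.induction_on_irreducible with
  | zero => exact absurd rfl hR
  | unit u hu => exact ⟨u, D_isUnit_eq_zero hu, 0, by simp⟩
  | mul a G ha hG ih =>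
    obtain ⟨c, hc, e, he⟩ := ih ha fun G' h1 h2 h3 => hS G' h1 h2 (h3.mul_left _)
    by_cases hd : KaehlerDifferential.D K (MvPolynomial (Fin n) K) G = 0
    · exact ⟨G * c, D_mul_eq_zero hd hc, e, by rw [he, mul_assoc]⟩
    · obtain ⟨s, hs, hGs⟩ := hS G hG hd (dvd_mul_right _ _)
      obtain ⟨u, rfl⟩ := hGs.symm
      refine ⟨u * c, D_mul_eq_zero (D_isUnit_eq_zero u.isUnit) hc, e + Pi.single s 1, ?_⟩
      have : ∏ t ∈ S, t ^ (Pi.single s 1 : MvPolynomial (Fin n) K → ℕ) t = s := by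
        rw [Finset.prod_eq_single_of_mem s hs]
        · simp
        · intro t _ hts
          simp [Pi.single_eq_of_ne hts]
      simp only [Pi.add_apply, pow_add, Finset.prod_mul_distrib, this]
      rw [he]
      ring

variable {K n} in
/-- In characteristic `p` the exponents can be taken smaller than `p`. -/
lemma exists_eq_const_mul_prod_pow_fin (p : ℕ) (hp : p.Prime) [CharP K p]
    (S : Finset (MvPolynomial (Fin n) K)) (R : MvPolynomial (Fin n) K) (hR : R ≠ 0)
    (hS : ∀ G, Irreducible G → KaehlerDifferential.D K (MvPolynomial (Fin n) K) G ≠ 0 → G ∣ R →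
      ∃ G' ∈ S, Associated G G') :
    ∃ e : S → Fin p, ∃ c, KaehlerDifferential.D K (MvPolynomial (Fin n) K) c = 0 ∧
      R = c * ∏ s : S, (s : MvPolynomial (Fin n) K) ^ (e s : ℕ) := by
  obtain ⟨c, hc, e, he⟩ := exists_eq_const_mul_prod_pow S R hR hS
  refine ⟨fun s => ⟨e s % p, Nat.mod_lt _ hp.pos⟩, c * (∏ s ∈ S, s ^ (e s / p)) ^ p,
    D_mul_eq_zero hc (D_pow_char_eq_zero p _), ?_⟩
  rw [Finset.prod_coe_sort S (fun s => s ^ (e s % p)), mul_assoc, ← Finset.prod_pow,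
    ← Finset.prod_mul_distrib, he]
  congr 1
  refine Finset.prod_congr rfl fun s _ => ?_
  rw [← pow_mul, ← pow_add, Nat.div_add_mod']

variable {K n} in
lemma infinite_pPolyConsts (p : ℕ) (hp : p.Prime) (i : Fin n) :
    Infinite (pPolyConsts K n p) := by
  refine Infinite.of_injective (fun k : ℕ => (⟨(X i ^ p) ^ k,
    pow_mem (Algebra.subset_adjoin (Set.mem_range_self i)) k⟩ : pPolyConsts K n p))
    fun k l hkl => ?_
  have h := congrArg (fun a : pPolyConsts K n p => totalDegree a.1) hkl
  simp only [← pow_mul, totalDegree_X_pow] at h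
  exact Nat.eq_of_mul_eq_mul_left hp.pos h

/-- Let `K` have characteristic `p > 0` and let `f = P/Q ∈ K(z)` with `df ≠ 0`. Then there
are infinitely many pairwise non-associate irreducible polynomials `G` with `dG ≠ 0` such
that `G` divides `P + λQ` for some `λ ∈ K[zᵖ]`: given any finite set `S`, one can find such
a `G` associate to no member of `S`. -/
theorem statement14 (p : ℕ) (hp : p.Prime) [CharP K p]
    (P Q : MvPolynomial (Fin n) K) (hQ : Q ≠ 0)
    (hdf : KaehlerDifferential.D K (Kz K n) (toKz K n P / toKz K n Q) ≠ 0) :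
    ∀ S : Finset (MvPolynomial (Fin n) K), ∃ G : MvPolynomial (Fin n) K,
      Irreducible G ∧
      KaehlerDifferential.D K (MvPolynomial (Fin n) K) G ≠ 0 ∧
      (∃ lam ∈ pPolyConsts K n p, G ∣ P + lam * Q) ∧
      ∀ G' ∈ S, ¬ Associated G G' := by
  intro S
  by_contra! hcon
  have hQ' : toKz K n Q ≠ 0 :=
    (map_ne_zero_iff _ (IsFractionRing.injective (MvPolynomial (Fin n) K) (Kz K n))).mpr hQ
  have hinf : Infinite (pPolyConsts K n p) := by
    rcases isEmpty_or_nonempty (Fin n) with hn | ⟨⟨i⟩⟩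
    · have hC : ∀ a : MvPolynomial (Fin n) K,
          KaehlerDifferential.D K (MvPolynomial (Fin n) K) a = 0 := fun a => by
        rw [eq_C_of_isEmpty a]
        exact Derivation.map_algebraMap _ _
      exact absurd (D_eq_zero_of_mul_eq (hC Q) (hC P) hQ (mul_div_cancel₀ _ hQ')) hdf
    · exact infinite_pPolyConsts p hp i
  have hne : ∀ l : pPolyConsts K n p, P + l * Q ≠ 0 := fun l hl => by
    refine hdf (D_eq_zero_of_mul_eq (a := 1) (b := -(l : MvPolynomial (Fin n) K))
      (D_isUnit_eq_zero isUnit_one) ?_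
      one_ne_zero ?_)
    · rw [map_neg, D_eq_zero_of_mem_pPolyConsts p l.2, neg_zero]
    · rw [map_one, one_mul, div_eq_iff hQ', ← map_mul]
      congr 1
      linear_combination hl
  choose e c hc he using fun l : pPolyConsts K n p =>
    exists_eq_const_mul_prod_pow_fin p hp S (P + l * Q) (hne l)
      fun G hG hd hdvd => hcon G hG hd ⟨l, l.2, hdvd⟩
  obtain ⟨l, m, hlm, helm⟩ := Finite.exists_ne_map_eq_of_infinite e
  have hl := he l
  have hm := he m
  rw [helm] at hl
  have hrel : (c m - c l) * P = (c l * m - c m * l) * Q := by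
    linear_combination c m * hl - c l * hm
  have hcc : c m = c l := by
    by_contra hcc
    refine hdf (D_eq_zero_of_mul_eq (a := c m - c l) (b := c l * m - c m * l) ?_ ?_
      (sub_ne_zero.mpr hcc) ?_)
    · rw [map_sub, hc, hc, sub_zero]
    · rw [map_sub, D_mul_eq_zero (hc l) (D_eq_zero_of_mem_pPolyConsts p m.2),
        D_mul_eq_zero (hc m) (D_eq_zero_of_mem_pPolyConsts p l.2), sub_zero]
    · rw [← mul_div_assoc, div_eq_iff hQ', ← map_mul, ← map_mul, hrel]
  rw [hcc, ← hl] at hm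
  exact hlm (Subtype.ext (mul_right_cancel₀ hQ (add_left_cancel hm)).symm)
end
end
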